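/- Let R be a commutative ring such that every Gorenstein flat R-module is strongly Gorenstein flat. Then R is SG-semihereditary if, and only if, every finitely generated ideal of R is strongly Gorenstein projective. -/

import Mathlib

noncomputable section

universe u

variable (R : Type u) [CommRing R]

/-- `IsShortExact R f g` says that `0 → A → B → C → 0` is a short exact sequence. -/
def IsShortExact {A B C : Type u} [AddCommGroup A] [Module R A] [AddCommGroup B] [Module R B]
    [AddCommGroup C] [Module R C] (f : A →ₗ[R] B) (g : B →ₗ[R] C) : Prop :=
  Function.Injective f ∧ Function.Surjective g ∧ LinearMap.range f = LinearMap.ker g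

/-- A module `M` is Gorenstein projective if there is a complete projective resolution
`⋯ → P i → P (i+1) → ⋯` (an exact sequence of projective modules which remains exact after
applying `Hom(-, Q)` for every projective module `Q`) with `M ≅ Im (P 0 → P 1)`. -/
def IsGorensteinProjective (M : Type u) [AddCommGroup M] [Module R M] : Prop :=
  ∃ (P : ℤ → Type u) (_ : ∀ i, AddCommGroup (P i)) (_ : ∀ i, Module R (P i))
    (d : ∀ i, P i →ₗ[R] P (i + 1)),
    (∀ i, Module.Projective R (P i)) ∧
    (∀ i, LinearMap.range (d i) = LinearMap.ker (d (i + 1))) ∧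
    Nonempty (M ≃ₗ[R] LinearMap.range (d 0)) ∧
    (∀ (Q : Type u) (_ : AddCommGroup Q) (_ : Module R Q), Module.Projective R Q →
      ∀ (i : ℤ) (g : P (i + 1) →ₗ[R] Q), g.comp (d i) = 0 →
        ∃ h : P (i + 1 + 1) →ₗ[R] Q, h.comp (d (i + 1)) = g)

/-- A module `M` is strongly Gorenstein projective if there is a complete projective
resolution of the form `⋯ → P →f P →f P → ⋯` with `M ≅ Im f`. -/
def IsStronglyGorensteinProjective (M : Type u) [AddCommGroup M] [Module R M] : Prop :=
  ∃ (P : Type u) (_ : AddCommGroup P) (_ : Module R P) (f : P →ₗ[R] P),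
    Module.Projective R P ∧
    LinearMap.range f = LinearMap.ker f ∧
    Nonempty (M ≃ₗ[R] LinearMap.range f) ∧
    (∀ (Q : Type u) (_ : AddCommGroup Q) (_ : Module R Q), Module.Projective R Q →
      ∀ g : P →ₗ[R] Q, g.comp f = 0 → ∃ h : P →ₗ[R] Q, h.comp f = g)

/-- A module `M` is Gorenstein flat if there is an exact sequence of flat modules
`⋯ → F i → F (i+1) → ⋯` which remains exact after applying `- ⊗ I` for every injective
module `I`, with `M ≅ Im (F 0 → F 1)`. -/
def IsGorensteinFlat (M : Type u) [AddCommGroup M] [Module R M] : Prop :=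
  ∃ (F : ℤ → Type u) (_ : ∀ i, AddCommGroup (F i)) (_ : ∀ i, Module R (F i))
    (d : ∀ i, F i →ₗ[R] F (i + 1)),
    (∀ i, Module.Flat R (F i)) ∧
    (∀ i, LinearMap.range (d i) = LinearMap.ker (d (i + 1))) ∧
    Nonempty (M ≃ₗ[R] LinearMap.range (d 0)) ∧
    (∀ (I : Type u) (_ : AddCommGroup I) (_ : Module R I), Module.Injective R I →
      ∀ i : ℤ, LinearMap.range (LinearMap.rTensor I (d i)) =
        LinearMap.ker (LinearMap.rTensor I (d (i + 1))))

/-- A module `M` is strongly Gorenstein flat if there is an exact sequence of flat modules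
of the form `⋯ → F →f F →f F → ⋯` which remains exact after applying `- ⊗ I` for every
injective module `I`, with `M ≅ Im f`. -/
def IsStronglyGorensteinFlat (M : Type u) [AddCommGroup M] [Module R M] : Prop :=
  ∃ (F : Type u) (_ : AddCommGroup F) (_ : Module R F) (f : F →ₗ[R] F),
    Module.Flat R F ∧
    LinearMap.range f = LinearMap.ker f ∧
    Nonempty (M ≃ₗ[R] LinearMap.range f) ∧
    (∀ (I : Type u) (_ : AddCommGroup I) (_ : Module R I), Module.Injective R I →
      LinearMap.range (LinearMap.rTensor I f) = LinearMap.ker (LinearMap.rTensor I f))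

/-- `ProjDimLE R M n` : the projective dimension of `M` is at most `n`, i.e. there is an exact
sequence `0 → P n → ⋯ → P 0 → M → 0` with each `P i` projective. -/
def ProjDimLE (M : Type u) [AddCommGroup M] [Module R M] (n : ℕ) : Prop :=
  ∃ (P : ℕ → Type u) (_ : ∀ i, AddCommGroup (P i)) (_ : ∀ i, Module R (P i))
    (d : ∀ i, P (i + 1) →ₗ[R] P i) (ε : P 0 →ₗ[R] M),
    (∀ i, Module.Projective R (P i)) ∧
    (∀ i, n < i → Subsingleton (P i)) ∧
    Function.Surjective ε ∧
    LinearMap.ker ε = LinearMap.range (d 0) ∧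
    (∀ i, LinearMap.ker (d i) = LinearMap.range (d (i + 1)))

/-- `InjDimLE R M n` : the injective dimension of `M` is at most `n`, i.e. there is an exact
sequence `0 → M → E 0 → ⋯ → E n → 0` with each `E i` injective. -/
def InjDimLE (M : Type u) [AddCommGroup M] [Module R M] (n : ℕ) : Prop :=
  ∃ (E : ℕ → Type u) (_ : ∀ i, AddCommGroup (E i)) (_ : ∀ i, Module R (E i))
    (d : ∀ i, E i →ₗ[R] E (i + 1)) (η : M →ₗ[R] E 0),
    (∀ i, Module.Injective R (E i)) ∧
    (∀ i, n < i → Subsingleton (E i)) ∧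
    Function.Injective η ∧
    LinearMap.range η = LinearMap.ker (d 0) ∧
    (∀ i, LinearMap.range (d i) = LinearMap.ker (d (i + 1)))

/-- `FlatDimLE R M n` : the flat dimension of `M` is at most `n`. -/
def FlatDimLE (M : Type u) [AddCommGroup M] [Module R M] (n : ℕ) : Prop :=
  ∃ (F : ℕ → Type u) (_ : ∀ i, AddCommGroup (F i)) (_ : ∀ i, Module R (F i))
    (d : ∀ i, F (i + 1) →ₗ[R] F i) (ε : F 0 →ₗ[R] M),
    (∀ i, Module.Flat R (F i)) ∧
    (∀ i, n < i → Subsingleton (F i)) ∧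
    Function.Surjective ε ∧
    LinearMap.ker ε = LinearMap.range (d 0) ∧
    (∀ i, LinearMap.ker (d i) = LinearMap.range (d (i + 1)))

/-- `GProjDimLE R M n` : the Gorenstein projective dimension of `M` is at most `n`, i.e.
there is an exact sequence `0 → G n → ⋯ → G 0 → M → 0` with each `G i` Gorenstein
projective. -/
def GProjDimLE (M : Type u) [AddCommGroup M] [Module R M] (n : ℕ) : Prop :=
  ∃ (G : ℕ → Type u) (_ : ∀ i, AddCommGroup (G i)) (_ : ∀ i, Module R (G i))
    (d : ∀ i, G (i + 1) →ₗ[R] G i) (ε : G 0 →ₗ[R] M),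
    (∀ i, IsGorensteinProjective R (G i)) ∧
    (∀ i, n < i → Subsingleton (G i)) ∧
    Function.Surjective ε ∧
    LinearMap.ker ε = LinearMap.range (d 0) ∧
    (∀ i, LinearMap.ker (d i) = LinearMap.range (d (i + 1)))

/-- `GFlatDimLE R M n` : the Gorenstein flat dimension of `M` is at most `n`. -/
def GFlatDimLE (M : Type u) [AddCommGroup M] [Module R M] (n : ℕ) : Prop :=
  ∃ (G : ℕ → Type u) (_ : ∀ i, AddCommGroup (G i)) (_ : ∀ i, Module R (G i))
    (d : ∀ i, G (i + 1) →ₗ[R] G i) (ε : G 0 →ₗ[R] M),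
    (∀ i, IsGorensteinFlat R (G i)) ∧
    (∀ i, n < i → Subsingleton (G i)) ∧
    Function.Surjective ε ∧
    LinearMap.ker ε = LinearMap.range (d 0) ∧
    (∀ i, LinearMap.ker (d i) = LinearMap.range (d (i + 1)))

/-- A module is finitely presented if it is the quotient of a finite free module by a
finitely generated submodule of relations. -/
def IsFinitelyPresented (M : Type u) [AddCommGroup M] [Module R M] : Prop :=
  ∃ (n : ℕ) (f : (Fin n → R) →ₗ[R] M), Function.Surjective f ∧ (LinearMap.ker f).FG

/-- A ring is coherent if every finitely generated ideal is finitely presented. -/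
def IsCoherentRing : Prop :=
  ∀ I : Ideal R, I.FG → IsFinitelyPresented R I

/-- `ExtVanishes R M N i` : `Ext_R^i(M, N) = 0`. -/
def ExtVanishes (M N : Type u) [AddCommGroup M] [Module R M] [AddCommGroup N] [Module R N]
    (i : ℕ) : Prop :=
  Subsingleton (((Ext R (ModuleCat.{u} R) i).obj
    (Opposite.op (ModuleCat.of R M))).obj (ModuleCat.of R N))

/-- A ring is hereditary if every submodule of a projective module is projective. -/
def IsHereditaryRing : Prop :=
  ∀ (P : Type u) (_ : AddCommGroup P) (_ : Module R P), Module.Projective R P →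
    ∀ N : Submodule R P, Module.Projective R N

/-- A ring is semihereditary if every finitely generated ideal is projective. -/
def IsSemihereditaryRing : Prop :=
  ∀ I : Ideal R, I.FG → Module.Projective R I

/-- A ring is Gorenstein hereditary if every submodule of a projective module is
Gorenstein projective. -/
def IsGHereditaryRing : Prop :=
  ∀ (P : Type u) (_ : AddCommGroup P) (_ : Module R P), Module.Projective R P →
    ∀ N : Submodule R P, IsGorensteinProjective R N

/-- A ring is strongly Gorenstein hereditary if every submodule of a projective module is
strongly Gorenstein projective. -/
def IsSGHereditaryRing : Prop :=
  ∀ (P : Type u) (_ : AddCommGroup P) (_ : Module R P), Module.Projective R P →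
    ∀ N : Submodule R P, IsStronglyGorensteinProjective R N

/-- A ring is Gorenstein semihereditary if it is coherent and every submodule of a flat
module is Gorenstein flat. -/
def IsGSemihereditaryRing : Prop :=
  IsCoherentRing R ∧
    ∀ (F : Type u) (_ : AddCommGroup F) (_ : Module R F), Module.Flat R F →
      ∀ N : Submodule R F, IsGorensteinFlat R N

/-- A ring is strongly Gorenstein semihereditary if it is coherent and every submodule of a
flat module is strongly Gorenstein flat. -/
def IsSGSemihereditaryRing : Prop :=
  IsCoherentRing R ∧
    ∀ (F : Type u) (_ : AddCommGroup F) (_ : Module R F), Module.Flat R F →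
      ∀ N : Submodule R F, IsStronglyGorensteinFlat R N

section

variable {R}

open TensorProduct

/-- A homomorphism killing the kernel of `β : A → B` extends along `β` when the target is
injective. -/
theorem Module.Injective.exists_comp_eq {A B E : Type u} [AddCommGroup A] [Module R A]
    [AddCommGroup B] [Module R B] [AddCommGroup E] [Module R E] (hE : Module.Injective R E)
    (β : A →ₗ[R] B) (c : A →ₗ[R] E) (h : LinearMap.ker β ≤ LinearMap.ker c) :
    ∃ c' : B →ₗ[R] E, c'.comp β = c := by
  obtain ⟨c', hc'⟩ := hE.out ((LinearMap.ker β).liftQ β le_rfl)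
    (LinearMap.ker_eq_bot.mp (Submodule.ker_liftQ_eq_bot' _ _ rfl)) ((LinearMap.ker β).liftQ c h)
  exact ⟨c', LinearMap.ext fun a ↦ by simpa using hc' (Submodule.Quotient.mk a)⟩

/-- A character killing the kernel of `β : A → B` extends along `β`. -/
theorem CharacterModule.exists_comp_eq {A B : Type*} [AddCommGroup A] [Module R A]
    [AddCommGroup B] [Module R B] (β : A →ₗ[R] B) (c : CharacterModule A)
    (h : ∀ a, β a = 0 → c a = 0) : ∃ c' : CharacterModule B, ∀ a, c' (β a) = c a := by
  have hinj : Function.Injective ((LinearMap.ker β).liftQ β le_rfl) :=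
    LinearMap.ker_eq_bot.mp (Submodule.ker_liftQ_eq_bot' _ _ rfl)
  obtain ⟨c', hc'⟩ := CharacterModule.dual_surjective_of_injective _ hinj
    (QuotientAddGroup.lift (LinearMap.ker β).toAddSubgroup c (fun a ha ↦ h a ha) :
      A ⧸ (LinearMap.ker β).toAddSubgroup →+ AddCircle (1 : ℚ))
  exact ⟨c', fun a ↦ DFunLike.congr_fun hc' (Submodule.Quotient.mk a)⟩

/-- A submodule is cut out by characters. -/
theorem CharacterModule.mem_of_forall {A : Type*} [AddCommGroup A] [Module R A]
    (S : Submodule R A) (a : A) (h : ∀ c : CharacterModule A, (∀ s ∈ S, c s = 0) → c a = 0) :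
    a ∈ S := by
  rw [← Submodule.Quotient.mk_eq_zero]
  refine CharacterModule.eq_zero_of_character_apply fun c ↦ ?_
  refine h (CharacterModule.dual S.mkQ c) fun s hs ↦ ?_
  change c (S.mkQ s) = 0
  rw [Submodule.mkQ_apply, (Submodule.Quotient.mk_eq_zero S).mpr hs, map_zero]

/-- The evaluation map `P ⊗ Hom(Q, X) → Hom(Hom(P, Q), X)`. -/
def tensorHomEval (P Q X : Type*) [AddCommGroup P] [Module R P] [AddCommGroup Q] [Module R Q]
    [AddCommGroup X] [Module R X] : P ⊗[R] (Q →ₗ[R] X) →ₗ[R] ((P →ₗ[R] Q) →ₗ[R] X) :=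
  TensorProduct.lift
    (LinearMap.mk₂ R (fun p ψ ↦ ψ.comp (LinearMap.applyₗ p))
      (fun _ _ _ ↦ by ext; simp) (fun _ _ _ ↦ by ext; simp)
      (fun _ _ _ ↦ by ext; simp) (fun _ _ _ ↦ by ext; simp))

section tensorHomEval

variable {P Q X : Type*} [AddCommGroup P] [Module R P] [AddCommGroup Q] [Module R Q]
  [AddCommGroup X] [Module R X]

@[simp]
theorem tensorHomEval_tmul (p : P) (ψ : Q →ₗ[R] X) (g : P →ₗ[R] Q) :
    tensorHomEval P Q X (p ⊗ₜ ψ) g = ψ (g p) := rfl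

theorem tensorHomEval_rTensor (f : P →ₗ[R] P) (t : P ⊗[R] (Q →ₗ[R] X)) (g : P →ₗ[R] Q) :
    tensorHomEval P Q X (f.rTensor _ t) g = tensorHomEval P Q X t (g.comp f) := by
  induction t with
  | zero => simp
  | tmul p ψ => simp
  | add a b ha hb => simp [ha, hb]

theorem exists_dualBasis (P : Type*) [AddCommGroup P] [Module R P] [Module.Finite R P]
    [Module.Projective R P] :
    ∃ (n : ℕ) (e : Fin n → P) (φ : Fin n → P →ₗ[R] R), ∀ p, ∑ i, φ i p • e i = p := by
  obtain ⟨n, f, g, -, -, hfg⟩ := Module.Finite.exists_comp_eq_id_of_projective R P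
  refine ⟨n, fun i ↦ f (Pi.single i 1), fun i ↦ (LinearMap.proj i).comp g, fun p ↦ ?_⟩
  conv_rhs => rw [← LinearMap.id_apply (R := R) p, ← hfg, LinearMap.comp_apply,
    ← (Pi.basisFun R (Fin n)).sum_repr (g p), map_sum]
  simp

theorem tensorHomEval_bijective [Module.Finite R P] [Module.Projective R P] :
    Function.Bijective (tensorHomEval (R := R) P Q X) := by
  obtain ⟨n, e, φ, h⟩ := exists_dualBasis (R := R) P
  let inv (c : (P →ₗ[R] Q) →ₗ[R] X) : P ⊗[R] (Q →ₗ[R] X) :=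
    ∑ i, e i ⊗ₜ c.comp (LinearMap.smulRightₗ (φ i))
  refine Function.bijective_iff_has_inverse.mpr ⟨inv, fun t ↦ ?_, fun c ↦ ?_⟩
  · induction t with
    | zero => simp [inv]
    | tmul p ψ =>
      conv_rhs => rw [← h p, TensorProduct.sum_tmul]
      refine Finset.sum_congr rfl fun i _ ↦ ?_
      rw [TensorProduct.smul_tmul]
      congr 1
      ext q
      simp
    | add a b ha hb =>
      simp only [inv] at ha hb ⊢
      conv_rhs => rw [← ha, ← hb]
      simp [LinearMap.add_comp, TensorProduct.tmul_add, Finset.sum_add_distrib]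
  · ext g
    simp only [inv, map_sum, LinearMap.sum_apply, tensorHomEval_tmul, LinearMap.comp_apply]
    rw [← map_sum]
    congr 1
    ext p
    conv_rhs => rw [← h p, map_sum]
    simp [LinearMap.sum_apply]

end tensorHomEval

theorem rTensor_lTensor_comm {X X' Y Y' : Type*} [AddCommGroup X] [Module R X] [AddCommGroup X']
    [Module R X'] [AddCommGroup Y] [Module R Y] [AddCommGroup Y'] [Module R Y'] (f : X →ₗ[R] X')
    (g : Y →ₗ[R] Y') (z : X ⊗[R] Y) :
    f.rTensor Y' (g.lTensor X z) = g.lTensor X' (f.rTensor Y z) := by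
  rw [← LinearMap.comp_apply, ← LinearMap.comp_apply, LinearMap.rTensor_comp_lTensor,
    LinearMap.lTensor_comp_rTensor]

theorem CharacterModule.sum_apply {A ι : Type*} [AddCommGroup A] (s : Finset ι)
    (c : ι → CharacterModule A) (a : A) : (∑ i ∈ s, c i) a = ∑ i ∈ s, c i a :=
  AddMonoidHom.finsetSum_apply c s a

/-- If `0 → K → P → N → 0` and `0 → A → B → E → 0` are exact, the injectivity of `K ⊗ E → P ⊗ E`
follows from that of `K ⊗ B → P ⊗ B` and `N ⊗ A → N ⊗ B`. -/
theorem rTensor_injective_of_lTensor_injective {K P N A B E : Type*}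
    [AddCommGroup K] [Module R K] [AddCommGroup P] [Module R P] [AddCommGroup N] [Module R N]
    [AddCommGroup A] [Module R A] [AddCommGroup B] [Module R B] [AddCommGroup E] [Module R E]
    {i : K →ₗ[R] P} {p : P →ₗ[R] N} {a : A →ₗ[R] B} {b : B →ₗ[R] E}
    (hip : Function.Exact i p) (hp : Function.Surjective p)
    (hab : Function.Exact a b) (hb : Function.Surjective b)
    (hB : Function.Injective (i.rTensor B)) (hN : Function.Injective (a.lTensor N)) :
    Function.Injective (i.rTensor E) := by
  rw [injective_iff_map_eq_zero]
  intro z hz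
  obtain ⟨z', rfl⟩ := LinearMap.lTensor_surjective K hb z
  rw [rTensor_lTensor_comm] at hz
  obtain ⟨w, hw⟩ := (lTensor_exact P hab hb _).mp hz
  have hw0 : p.rTensor A w = 0 := by
    refine hN ?_
    rw [map_zero, ← rTensor_lTensor_comm, hw]
    exact (rTensor_exact B hip hp).apply_apply_eq_zero z'
  obtain ⟨v, rfl⟩ := (rTensor_exact A hip hp _).mp hw0
  rw [← rTensor_lTensor_comm] at hw
  rw [← hB hw]
  exact (lTensor_exact K hab hb).apply_apply_eq_zero v

/-- Over a ring whose finitely generated ideals are finitely presented, powers of the character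
module of `X` are flat provided maps from finitely generated ideals to `X` extend to the ring. -/
theorem flat_pi_characterModule (hfp : ∀ I : Ideal R, I.FG → Module.FinitePresentation R I)
    {X J : Type*} [AddCommGroup X] [Module R X]
    (hext : ∀ I : Ideal R, I.FG → ∀ g : I →ₗ[R] X, ∃ h : R →ₗ[R] X, ∀ x : I, h x = g x) :
    Module.Flat R (J → CharacterModule X) := by
  refine Module.Flat.of_forall_isTrivialRelation fun {l f x} hfx ↦ ?_
  let π : (Fin l → R) →ₗ[R] R := Fintype.linearCombination R f
  have hπ : (LinearMap.range π).FG := Submodule.FG.of_finite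
  have := hfp _ hπ
  have hker : (LinearMap.ker π).FG := by
    rw [← LinearMap.ker_rangeRestrict]
    exact Module.FinitePresentation.fg_ker _ π.surjective_rangeRestrict
  obtain ⟨k, a, ha⟩ := Submodule.fg_iff_exists_fin_generating_family.mp hker
  let β : (Fin l → X) →ₗ[R] (Fin k → X) :=
    LinearMap.pi fun m ↦ ∑ i, a m i • LinearMap.proj i
  have key (j : J) : ∃ y : Fin k → CharacterModule X, ∀ i, x i j = ∑ m, a m i • y m := by
    let c : CharacterModule (Fin l → X) :=
      ∑ i, CharacterModule.dual (LinearMap.proj (R := R) i) (x i j)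
    have hc (ξ : Fin l → X) : c ξ = ∑ i, x i j (ξ i) :=
      CharacterModule.sum_apply _ _ _
    obtain ⟨c', hc'⟩ := CharacterModule.exists_comp_eq β c (fun ξ hξ ↦ by
      let ψ : (Fin l → R) →ₗ[R] X := Fintype.linearCombination R ξ
      have hψ : LinearMap.ker π ≤ LinearMap.ker ψ := by
        rw [← ha, Submodule.span_le]
        rintro _ ⟨m, rfl⟩
        simpa [β, ψ, Fintype.linearCombination_apply] using congr_fun hξ m
      obtain ⟨h, hh⟩ := hext _ hπ
        (((LinearMap.ker π).liftQ ψ hψ).comp π.quotKerEquivRange.symm.toLinearMap)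
      have hξ (i : Fin l) : ξ i = f i • h 1 := by
        have h1 := hh ⟨π (Pi.single i 1), _, rfl⟩
        have h2 : π.quotKerEquivRange.symm ⟨π (Pi.single i 1), _, rfl⟩ =
          Submodule.Quotient.mk (Pi.single i 1) := by
          rw [LinearEquiv.symm_apply_eq]; rfl
        rw [LinearMap.comp_apply, LinearEquiv.coe_coe, h2] at h1
        rw [← map_smul]
        simpa [π, ψ, Fintype.linearCombination_apply_single] using h1.symm
      rw [hc]
      have := congr($(congr_fun hfx j) (h 1))
      rw [Finset.sum_apply, CharacterModule.sum_apply] at this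
      simp_rw [hξ]
      exact this)
    refine ⟨fun m ↦ CharacterModule.dual (LinearMap.single R (fun _ ↦ X) m) c', fun i ↦ ?_⟩
    ext v
    have h1 := hc' (Pi.single i v)
    rw [hc, Finset.sum_eq_single i (fun b _ hb ↦ by rw [Pi.single_eq_of_ne hb, map_zero])
      (fun h ↦ absurd (Finset.mem_univ i) h), Pi.single_eq_same] at h1
    rw [← h1, CharacterModule.sum_apply]
    have h2 : β (Pi.single i v) = ∑ m, Pi.single m (a m i • v) := by
      rw [Finset.univ_sum_single]
      ext m
      simp [β, Finset.sum_apply, Pi.single_apply]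
    rw [h2, map_sum]
    rfl
  choose y hy using key
  refine ⟨k, fun i m ↦ a m i, fun m j ↦ y j m, fun i ↦ ?_, fun m ↦ ?_⟩
  · ext1 j
    simpa using hy j i
  · have : a m ∈ LinearMap.ker π := ha ▸ Submodule.subset_span ⟨m, rfl⟩
    simpa [π, Fintype.linearCombination_apply, mul_comm] using this

/-- If `Hom(-, Q)` leaves `P → P → P` exact, where `P` is finitely generated projective, then so
does `- ⊗ Hom(Q, X)` for every injective module `X`. -/
theorem exists_rTensor_hom_eq {P Q X : Type u} [AddCommGroup P] [Module R P] [AddCommGroup Q]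
    [Module R Q] [AddCommGroup X] [Module R X] [Module.Finite R P] [Module.Projective R P]
    (hX : Module.Injective R X) (f : P →ₗ[R] P)
    (hf : ∀ v : P →ₗ[R] Q, v.comp f = 0 → ∃ w : P →ₗ[R] Q, w.comp f = v)
    (t : P ⊗[R] (Q →ₗ[R] X)) (ht : f.rTensor _ t = 0) : ∃ s, f.rTensor _ s = t := by
  obtain ⟨c', hc'⟩ := hX.exists_comp_eq (LinearMap.lcomp R Q f) (tensorHomEval P Q X t)
    fun v hv ↦ by
      obtain ⟨w, rfl⟩ := hf v hv
      rw [LinearMap.mem_ker, ← tensorHomEval_rTensor, ht, map_zero, LinearMap.zero_apply]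
  obtain ⟨s, rfl⟩ := tensorHomEval_bijective.2 c'
  refine ⟨s, tensorHomEval_bijective.1 (LinearMap.ext fun g ↦ ?_)⟩
  rw [tensorHomEval_rTensor]
  exact LinearMap.congr_fun hc' g

theorem exists_rTensor_eq {P E : Type u} [AddCommGroup P] [Module R P]
    [AddCommGroup E] [Module R E] [Module.Finite R P] [Module.Projective R P]
    (hE : Module.Injective R E) (f : P →ₗ[R] P)
    (hf : ∀ v : P →ₗ[R] R, v.comp f = 0 → ∃ w : P →ₗ[R] R, w.comp f = v)
    (t : P ⊗[R] E) (ht : f.rTensor E t = 0) : ∃ s, f.rTensor E s = t := by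
  let e := LinearMap.ringLmapEquivSelf R R E
  obtain ⟨s, hs⟩ := exists_rTensor_hom_eq (Q := R) hE f hf (e.symm.toLinearMap.lTensor P t) (by
    rw [rTensor_lTensor_comm, ht, map_zero])
  refine ⟨e.toLinearMap.lTensor P s, ?_⟩
  rw [rTensor_lTensor_comm, hs, ← LinearMap.comp_apply, ← LinearMap.lTensor_comp]
  simp

/-- If `- ⊗ Hom(Q, R⋆)` leaves `P → P → P` exact, where `P` is finitely generated projective, then
so does `Hom(-, Q)`. -/
theorem exists_comp_eq_of_rTensor {P Q : Type*} [AddCommGroup P] [Module R P] [AddCommGroup Q]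
    [Module R Q] [Module.Finite R P] [Module.Projective R P] (f : P →ₗ[R] P)
    (hf : ∀ t : P ⊗[R] (Q →ₗ[R] CharacterModule R), f.rTensor _ t = 0 → ∃ s, f.rTensor _ s = t)
    (v : P →ₗ[R] Q) (hv : v.comp f = 0) : ∃ w : P →ₗ[R] Q, w.comp f = v := by
  refine CharacterModule.mem_of_forall (LinearMap.range (LinearMap.lcomp R Q f)) v fun c hc ↦ ?_
  let c' : (P →ₗ[R] Q) →ₗ[R] CharacterModule R :=
    CharacterModule.curry (CharacterModule.dual (TensorProduct.rid R _).toLinearMap c)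
  have hc' (g : P →ₗ[R] Q) (r : R) : c' g r = c (r • g) := rfl
  obtain ⟨t, ht⟩ := tensorHomEval_bijective.2 c'
  obtain ⟨s, rfl⟩ := hf t (tensorHomEval_bijective.1 (LinearMap.ext fun g ↦ by
    rw [tensorHomEval_rTensor, ht]
    ext r
    rw [hc', map_zero]
    exact hc _ ⟨r • g, rfl⟩))
  have h1 := hc' v 1
  rw [← ht, tensorHomEval_rTensor, hv, map_zero, one_smul] at h1
  exact h1.symm

theorem injective_hom_characterModule (Q : Type u) [AddCommGroup Q] [Module R Q]
    [Module.Flat R Q] : Module.Injective R (Q →ₗ[R] CharacterModule R) := by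
  have h : Module.Injective R (CharacterModule (Q ⊗[R] R)) :=
    Module.Flat.iff_characterModule_injective.mp inferInstance
  exact Module.Injective.of_ringEquiv (RingEquiv.refl R) CharacterModule.homEquiv.symm

theorem exists_injective_embedding (M : Type u) [AddCommGroup M] [Module R M] :
    ∃ (E : Type u) (_ : AddCommGroup E) (_ : Module R E) (j : M →ₗ[R] E),
      Module.Injective R E ∧ Function.Injective j :=
  let J : ModuleCat.{u} R := CategoryTheory.Injective.under (ModuleCat.of R M)
  have : CategoryTheory.Injective (ModuleCat.of R J) :=
    CategoryTheory.Injective.injective_under (ModuleCat.of R M)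
  ⟨J, inferInstance, inferInstance, (CategoryTheory.Injective.ι (ModuleCat.of R M)).hom,
    Module.injective_module_of_injective_object R J,
    (ModuleCat.mono_iff_injective _).mp (CategoryTheory.Injective.ι_mono (ModuleCat.of R M))⟩

/-- There is an injective module containing a copy of every finitely generated module. -/
theorem exists_injective_universal : ∃ (G : Type u) (_ : AddCommGroup G) (_ : Module R G),
    Module.Injective R G ∧ ∀ (M : Type u) [AddCommGroup M] [Module R M] [Module.Finite R M],
      ∃ j : M →ₗ[R] G, Function.Injective j := by
  classical
  let Y (x : Σ n, Submodule R (Fin n → R)) := (Fin x.1 → R) ⧸ x.2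
  obtain ⟨G, _, _, j, hG, hj⟩ := exists_injective_embedding (R := R) (∀ x, Y x)
  refine ⟨G, _, _, hG, fun M _ _ _ ↦ ?_⟩
  obtain ⟨n, f, hf⟩ := Module.Finite.exists_fin' R M
  let x : Σ n, Submodule R (Fin n → R) := ⟨n, LinearMap.ker f⟩
  refine ⟨j ∘ₗ LinearMap.single R Y x ∘ₗ (f.quotKerEquivOfSurjective hf).symm.toLinearMap, ?_⟩
  exact hj.comp ((Pi.single_injective x).comp (LinearEquiv.injective _))

/-- Tensoring a map `N → F` to a flat module with injective modules can be tested on an injective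
module containing all finitely generated modules. -/
theorem rTensor_injective_of_universal {N F G E : Type u} [AddCommGroup N] [Module R N]
    [AddCommGroup F] [Module R F] [Module.Flat R F] [AddCommGroup G] [Module R G] [AddCommGroup E]
    [Module R E] (hE : Module.Injective R E)
    (hG : ∀ (M : Type u) [AddCommGroup M] [Module R M] [Module.Finite R M],
      ∃ j : M →ₗ[R] G, Function.Injective j)
    (j : N →ₗ[R] F) (hj : Function.Injective (j.rTensor G)) :
    Function.Injective (j.rTensor E) := by
  rw [injective_iff_map_eq_zero]
  intro z hz
  obtain ⟨E', _, h⟩ :=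
    TensorProduct.exists_finite_submodule_right_of_setFinite {z} (Set.finite_singleton z)
  obtain ⟨z', rfl⟩ := h rfl
  rw [rTensor_lTensor_comm] at hz
  replace hz := Module.Flat.lTensor_preserves_injective_linearMap (M := F) E'.subtype
    E'.injective_subtype (hz.trans (map_zero _).symm)
  obtain ⟨a, ha⟩ := hG E'
  obtain ⟨b, hb⟩ := hE.out a ha E'.subtype
  have h0 : a.lTensor N z' = 0 := hj (by rw [rTensor_lTensor_comm, hz, map_zero, map_zero])
  rw [← show b.comp a = E'.subtype from LinearMap.ext hb, LinearMap.lTensor_comp,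
    LinearMap.comp_apply, h0, map_zero]

/-- The evaluation map from a module to its double character module. -/
def CharacterModule.evalHom (M : Type*) [AddCommGroup M] [Module R M] :
    M →ₗ[R] CharacterModule (CharacterModule M) where
  toFun m := (AddMonoidHom.eval m : (M →+ AddCircle (1 : ℚ)) →+ AddCircle (1 : ℚ))
  map_add' _ _ := DFunLike.ext _ _ fun c : CharacterModule M ↦ map_add c _ _
  map_smul' _ _ := rfl

theorem CharacterModule.lTensor_evalHom_injective (N M : Type*) [AddCommGroup N] [Module R N]
    [AddCommGroup M] [Module R M] :
    Function.Injective ((CharacterModule.evalHom (R := R) M).lTensor N) := by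
  rw [injective_iff_map_eq_zero]
  refine fun z hz ↦ CharacterModule.eq_zero_of_character_apply fun χ ↦ ?_
  have key (z : N ⊗[R] M) : CharacterModule.uncurry
      ((CharacterModule.evalHom (CharacterModule M)).comp (CharacterModule.curry χ))
      ((CharacterModule.evalHom (R := R) M).lTensor N z) = χ z := by
    induction z with
    | zero => simp only [map_zero]
    | tmul n m => rfl
    | add a b ha hb => rw [map_add, map_add, map_add, ha, hb]
  rw [← key, hz, map_zero]

/-- The canonical map from `C` to a power of the character module of `G`. -/
def toPiCharacterModule (C G : Type*) [AddCommGroup C] [Module R C] [AddCommGroup G]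
    [Module R G] : C →ₗ[R] (CharacterModule (C ⊗[R] G) → CharacterModule G) :=
  LinearMap.pi fun χ ↦ CharacterModule.curry χ

theorem rTensor_toPiCharacterModule_injective (C G : Type*) [AddCommGroup C] [Module R C]
    [AddCommGroup G] [Module R G] :
    Function.Injective ((toPiCharacterModule (R := R) C G).rTensor G) := by
  rw [rTensor_injective_iff_lcomp_surjective]
  refine fun g ↦ ⟨LinearMap.proj (CharacterModule.uncurry g), ?_⟩
  exact CharacterModule.homEquiv.symm_apply_apply g

theorem toPiCharacterModule_injective {C G : Type*} [AddCommGroup C] [Module R C]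
    [AddCommGroup G] [Module R G] (ι : R →ₗ[R] G) (h : Function.Injective (ι.lTensor C)) :
    Function.Injective (toPiCharacterModule (R := R) C G) := by
  rw [injective_iff_map_eq_zero]
  intro x hx
  have h0 : x ⊗ₜ[R] ι 1 = 0 := CharacterModule.eq_zero_of_character_apply fun χ ↦
    DFunLike.congr_fun (congr_fun hx χ) (ι 1)
  have h1 : x ⊗ₜ[R] (1 : R) = 0 := h (by rw [LinearMap.lTensor_tmul, h0, map_zero])
  simpa using congr(TensorProduct.rid R C $h1)

/-- A finitely generated ideal which is strongly Gorenstein projective has a finitely generated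
projective self-extension with the expected dual exactness. -/
theorem IsStronglyGorensteinProjective.exists_finite {I : Ideal R}
    (hI : IsStronglyGorensteinProjective R I) (hfg : I.FG) :
    ∃ (P : Type u) (_ : AddCommGroup P) (_ : Module R P) (i : I →ₗ[R] P) (p : P →ₗ[R] I),
      Module.Projective R P ∧ Module.Finite R P ∧ Function.Injective i ∧ Function.Surjective p ∧
      Function.Exact i p ∧ ∀ v : P →ₗ[R] R, v.comp (i.comp p) = 0 →
        ∃ w : P →ₗ[R] R, w.comp (i.comp p) = v := by
  obtain ⟨P, _, _, f, hP, hf, ⟨e⟩, hv⟩ := hI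
  have : Module.Finite R I := Module.Finite.iff_fg.mpr hfg
  let i : I →ₗ[R] P := (LinearMap.range f).subtype ∘ₗ e.toLinearMap
  let p : P →ₗ[R] I := e.symm.toLinearMap ∘ₗ f.rangeRestrict
  have hip : i.comp p = f := by ext; simp [i, p]
  have hi : Function.Injective i := (LinearMap.range f).injective_subtype.comp e.injective
  have hp : Function.Surjective p := e.symm.surjective.comp f.surjective_rangeRestrict
  have hex : Function.Exact i p := by
    rw [LinearMap.exact_iff]
    simp [i, p, LinearMap.range_comp, LinearMap.ker_comp, hf]
  exact ⟨P, _, _, i, p, hP, Module.Finite.of_exact hex hp, hi, hp, hex,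
    hip ▸ hv R _ _ inferInstance⟩

theorem finitePresentation_of_isStronglyGorensteinProjective {I : Ideal R}
    (hI : IsStronglyGorensteinProjective R I) (hfg : I.FG) : Module.FinitePresentation R I := by
  obtain ⟨P, _, _, i, p, _, _, hi, hp, hex, -⟩ := hI.exists_finite hfg
  have := Module.finitePresentation_of_projective R P
  have : Module.Finite R I := Module.Finite.iff_fg.mpr hfg
  refine Module.finitePresentation_of_surjective p hp ?_
  rw [hex.linearMap_ker_eq]
  exact Submodule.FG.of_finite

/-- If finitely generated ideals are strongly Gorenstein projective, injective modules have flat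
dimension at most one. -/
theorem flat_of_exact_injective
    (H : ∀ I : Ideal R, I.FG → IsStronglyGorensteinProjective R I) {A B E : Type u}
    [AddCommGroup A] [Module R A] [AddCommGroup B] [Module R B] [AddCommGroup E] [Module R E]
    (hE : Module.Injective R E) [Module.Flat R B] {a : A →ₗ[R] B} {b : B →ₗ[R] E}
    (ha : Function.Injective a) (hab : Function.Exact a b) (hb : Function.Surjective b) :
    Module.Flat R A := by
  rw [Module.Flat.iff_rTensor_injective]
  intro I hI
  obtain ⟨P, _, _, i, p, _, _, hi, hp, hex, hdual⟩ := (H I hI).exists_finite hI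
  have hiE : Function.Injective (i.rTensor E) := by
    rw [injective_iff_map_eq_zero]
    intro z hz
    obtain ⟨z', rfl⟩ := LinearMap.rTensor_surjective E hp z
    rw [← LinearMap.comp_apply, ← LinearMap.rTensor_comp] at hz
    obtain ⟨s, rfl⟩ := exists_rTensor_eq hE _ hdual z' hz
    rw [← LinearMap.comp_apply, ← LinearMap.rTensor_comp, ← LinearMap.comp_assoc,
      hex.linearMap_comp_eq_zero, LinearMap.zero_comp, LinearMap.rTensor_zero,
      LinearMap.zero_apply]
  have haI : Function.Injective (a.rTensor I) :=
    rTensor_injective_of_lTensor_injective hab hb hex hp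
      (Module.Flat.rTensor_preserves_injective_linearMap a ha)
      ((LinearMap.lTensor_inj_iff_rTensor_inj _ _).mpr hiE)
  have hcomp : Function.Injective (a.lTensor R ∘ I.subtype.rTensor A) := by
    have : a.lTensor R ∘ I.subtype.rTensor A = I.subtype.rTensor B ∘ a.lTensor I :=
      funext fun z ↦ (rTensor_lTensor_comm _ _ z).symm
    rw [this]
    exact (Module.Flat.rTensor_preserves_injective_linearMap _ I.injective_subtype).comp
      ((LinearMap.lTensor_inj_iff_rTensor_inj _ _).mpr haI)
  exact hcomp.of_comp

/-- If `R` embeds in an injective module `G` and the ideal `I` is finitely generated and strongly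
Gorenstein projective, maps from `I` to `G / R` extend to the ring. -/
theorem exists_extend_quotient {I : Ideal R} (hI : IsStronglyGorensteinProjective R I)
    (hfg : I.FG) {G : Type u} [AddCommGroup G] [Module R G] (hG : Module.Injective R G)
    (ι : R →ₗ[R] G) (hι : Function.Injective ι) (g : I →ₗ[R] G ⧸ LinearMap.range ι) :
    ∃ h : R →ₗ[R] G ⧸ LinearMap.range ι, ∀ x : I, h x = g x := by
  obtain ⟨P, _, _, i, p, _, _, hi, hp, hex, hdual⟩ := hI.exists_finite hfg
  obtain ⟨u, hu⟩ := Module.projective_lifting_property (LinearMap.range ι).mkQ (g.comp p)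
    (Submodule.mkQ_surjective _)
  have hpi (x : I) : p (i x) = 0 := hex.apply_apply_eq_zero x
  have hmem (x : P) : u (i (p x)) ∈ LinearMap.range ι := by
    rw [← Submodule.Quotient.mk_eq_zero]
    simpa [hpi] using LinearMap.congr_fun hu (i (p x))
  let v : P →ₗ[R] R := (LinearEquiv.ofInjective ι hι).symm.toLinearMap ∘ₗ
    (u.comp (i.comp p)).codRestrict _ hmem
  have hv (x : P) : ι (v x) = u (i (p x)) :=
    congr_arg Subtype.val ((LinearEquiv.ofInjective ι hι).apply_symm_apply ⟨_, hmem x⟩)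
  obtain ⟨w, hw⟩ := hdual v (LinearMap.ext fun x ↦ hι (by simp [hv, hpi]))
  obtain ⟨k, hk⟩ : ∃ k : I →ₗ[R] G, k.comp p = u - ι.comp w := by
    refine hG.exists_comp_eq p _ fun x hx ↦ ?_
    obtain ⟨y, rfl⟩ := (hex x).mp hx
    obtain ⟨x, rfl⟩ := hp y
    have := LinearMap.congr_fun hw x
    simp only [LinearMap.comp_apply] at this
    simp [this, hv]
  obtain ⟨h, hh⟩ := hG.out I.subtype I.injective_subtype k
  refine ⟨(LinearMap.range ι).mkQ.comp h, fun x ↦ ?_⟩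
  obtain ⟨x, rfl⟩ := hp x
  have h1 := LinearMap.congr_fun hk x
  have h2 := LinearMap.congr_fun hu x
  simp only [LinearMap.comp_apply, LinearMap.sub_apply] at h1 h2
  rw [LinearMap.comp_apply, ← Submodule.subtype_apply, hh, h1, map_sub, h2, sub_eq_self]
  simp

/-- `M` is a submodule of a flat module. -/
def IsSubflat (M : Type u) [AddCommGroup M] [Module R M] : Prop :=
  ∃ (F : Type u) (_ : AddCommGroup F) (_ : Module R F) (j : M →ₗ[R] F),
    Module.Flat R F ∧ Function.Injective j

/-- There is a short exact sequence `0 → A → F → B → 0` with `F` flat, which stays exact after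
tensoring with injective modules. -/
def IsFlatStep (A B : Type u) [AddCommGroup A] [Module R A] [AddCommGroup B] [Module R B] :
    Prop :=
  ∃ (F : Type u) (_ : AddCommGroup F) (_ : Module R F) (j : A →ₗ[R] F) (p : F →ₗ[R] B),
    Module.Flat R F ∧ Function.Injective j ∧ Function.Exact j p ∧ Function.Surjective p ∧
    ∀ (I : Type u) (_ : AddCommGroup I) (_ : Module R I), Module.Injective R I →
      Function.Injective (j.rTensor I)

theorem exists_flat_presentation (N : Type u) [AddCommGroup N] [Module R N] :
    ∃ (K F : Type u) (_ : AddCommGroup K) (_ : Module R K) (_ : AddCommGroup F) (_ : Module R F)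
      (i : K →ₗ[R] F) (p : F →ₗ[R] N), Module.Flat R F ∧ Function.Injective i ∧
      Function.Exact i p ∧ Function.Surjective p :=
  ⟨LinearMap.ker (Finsupp.linearCombination R (id : N → N)), N →₀ R, inferInstance,
    inferInstance, inferInstance, inferInstance, Submodule.subtype _,
    Finsupp.linearCombination R (id : N → N), inferInstance, Submodule.injective_subtype _,
    LinearMap.exact_subtype_ker_map _, Finsupp.linearCombination_id_surjective R N⟩

theorem IsSubflat.exists_left (H : ∀ I : Ideal R, I.FG → IsStronglyGorensteinProjective R I)
    {N : Type u} [AddCommGroup N] [Module R N] (hN : IsSubflat (R := R) N) :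
    ∃ (K : Type u) (_ : AddCommGroup K) (_ : Module R K),
      IsSubflat (R := R) K ∧ IsFlatStep (R := R) K N := by
  obtain ⟨F, _, _, j, _, hj⟩ := hN
  obtain ⟨K, P, _, _, _, _, i, p, _, hi, hip, hp⟩ := exists_flat_presentation (R := R) N
  refine ⟨K, _, _, ⟨P, _, _, i, inferInstance, hi⟩, P, _, _, i, p, inferInstance, hi, hip, hp,
    fun E _ _ hE ↦ ?_⟩
  obtain ⟨A, B, _, _, _, _, a, b, _, ha, hab, hb⟩ := exists_flat_presentation (R := R) E
  have := flat_of_exact_injective H hE ha hab hb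
  refine rTensor_injective_of_lTensor_injective hip hp hab hb
    (Module.Flat.rTensor_preserves_injective_linearMap _ hi) ?_
  have hcomp : Function.Injective (j.rTensor B ∘ a.lTensor N) := by
    rw [show j.rTensor B ∘ a.lTensor N = a.lTensor F ∘ j.rTensor A from
      funext fun z ↦ rTensor_lTensor_comm _ _ z]
    exact (Module.Flat.lTensor_preserves_injective_linearMap _ ha).comp
      (Module.Flat.rTensor_preserves_injective_linearMap _ hj)
  exact hcomp.of_comp

theorem IsSubflat.exists_right (H : ∀ I : Ideal R, I.FG → IsStronglyGorensteinProjective R I)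
    {N : Type u} [AddCommGroup N] [Module R N] (hN : IsSubflat (R := R) N) :
    ∃ (C : Type u) (_ : AddCommGroup C) (_ : Module R C),
      IsSubflat (R := R) C ∧ IsFlatStep (R := R) N C := by
  obtain ⟨F, _, _, j, _, hj⟩ := hN
  obtain ⟨G, _, _, hG, hemb⟩ := exists_injective_universal (R := R)
  obtain ⟨ι, hι⟩ := hemb R
  have hfp (I : Ideal R) (hI : I.FG) : Module.FinitePresentation R I :=
    finitePresentation_of_isStronglyGorensteinProjective (H I hI) hI
  have hflat (J : Type u) : Module.Flat R (J → CharacterModule G) :=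
    flat_pi_characterModule hfp fun I _ g ↦ hG.out I.subtype I.injective_subtype g
  let L := G ⧸ LinearMap.range ι
  have hL : Module.Injective R (CharacterModule (CharacterModule L)) := by
    have : Module.Flat R (Unit → CharacterModule L) := flat_pi_characterModule hfp
      fun I hI ↦ exists_extend_quotient (H I hI) hI hG ι hι
    have : Module.Flat R (CharacterModule L) :=
      Module.Flat.of_linearEquiv (LinearEquiv.funUnique Unit R (CharacterModule L)).symm
    exact Module.Flat.iff_characterModule_injective.mp this
  have hιN : Function.Injective (ι.lTensor N) := by
    have hcomp : Function.Injective (j.rTensor G ∘ ι.lTensor N) := by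
      rw [show j.rTensor G ∘ ι.lTensor N = ι.lTensor F ∘ j.rTensor R from
        funext fun z ↦ rTensor_lTensor_comm _ _ z]
      exact (Module.Flat.lTensor_preserves_injective_linearMap _ hι).comp
        (Module.Flat.rTensor_preserves_injective_linearMap _ hj)
    exact hcomp.of_comp
  let t := toPiCharacterModule (R := R) N G
  have := hflat (CharacterModule (N ⊗[R] G))
  have ht (E : Type u) [AddCommGroup E] [Module R E] (hE : Module.Injective R E) :
      Function.Injective (t.rTensor E) :=
    rTensor_injective_of_universal hE hemb t (rTensor_toPiCharacterModule_injective N G)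
  have htL : Function.Injective (t.rTensor L) := by
    have hcomp : Function.Injective
        ((CharacterModule.evalHom L).lTensor _ ∘ t.rTensor L) := by
      rw [show (CharacterModule.evalHom L).lTensor _ ∘ t.rTensor L =
        t.rTensor _ ∘ (CharacterModule.evalHom L).lTensor N from
        funext fun z ↦ (rTensor_lTensor_comm _ _ z).symm]
      exact (ht _ hL).comp (CharacterModule.lTensor_evalHom_injective N L)
    exact hcomp.of_comp
  let C := (CharacterModule (N ⊗[R] G) → CharacterModule G) ⧸ LinearMap.range t
  have hex : Function.Exact t (LinearMap.range t).mkQ := LinearMap.exact_map_mkQ_range t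
  have hιC : Function.Injective (ι.rTensor C) :=
    rTensor_injective_of_lTensor_injective (LinearMap.exact_map_mkQ_range ι)
      (Submodule.mkQ_surjective _) hex (Submodule.mkQ_surjective _)
      (Module.Flat.rTensor_preserves_injective_linearMap _ hι)
      ((LinearMap.lTensor_inj_iff_rTensor_inj _ _).mpr htL)
  exact ⟨C, _, _, ⟨_, _, _, toPiCharacterModule C G, hflat _, toPiCharacterModule_injective ι
    ((LinearMap.lTensor_inj_iff_rTensor_inj _ _).mpr hιC)⟩, _, _, _, t,
    (LinearMap.range t).mkQ, this, toPiCharacterModule_injective ι hιN, hex,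
    Submodule.mkQ_surjective _, fun E _ _ hE ↦ ht E hE⟩


theorem exists_int_chain {α : Type*} {r : α → α → Prop} (hl : ∀ x, ∃ y, r y x)
    (hr : ∀ x, ∃ y, r x y) (x : α) : ∃ N : ℤ → α, N 1 = x ∧ ∀ i, r (N i) (N (i + 1)) := by
  choose a ha using hl
  choose b hb using hr
  let N : ℤ → α
    | Int.ofNat n => b^[n] x
    | Int.negSucc n => a^[n + 1] x
  have hN (i : ℤ) : r (N i) (N (i + 1)) := by
    match i with
    | Int.ofNat n =>
      change r (b^[n] x) (b^[n + 1] x)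
      rw [Function.iterate_succ_apply']
      exact hb _
    | Int.negSucc 0 => exact ha x
    | Int.negSucc (n + 1) =>
      change r (a^[n + 1 + 1] x) (a^[n + 1] x)
      rw [Function.iterate_succ_apply']
      exact ha _
  refine ⟨fun i ↦ N (i - 1), rfl, fun i ↦ ?_⟩
  change r (N (i - 1)) (N (i + 1 - 1))
  simpa only [sub_add_cancel, add_sub_cancel_right] using hN (i - 1)

/-- If finitely generated ideals are strongly Gorenstein projective, submodules of flat modules are
Gorenstein flat. -/
theorem IsSubflat.isGorensteinFlat
    (H : ∀ I : Ideal R, I.FG → IsStronglyGorensteinProjective R I)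
    {M : Type u} [AddCommGroup M] [Module R M] (hM : IsSubflat (R := R) M) :
    IsGorensteinFlat R M := by
  obtain ⟨N, hN1, hN⟩ := exists_int_chain
    (α := {M : ModuleCat.{u} R // IsSubflat (R := R) M})
    (r := fun A B ↦ IsFlatStep (R := R) A.1 B.1)
    (fun x ↦ by
      obtain ⟨K, _, _, hK, h⟩ := x.2.exists_left H
      exact ⟨⟨ModuleCat.of R K, hK⟩, h⟩)
    (fun x ↦ by
      obtain ⟨K, _, _, hK, h⟩ := x.2.exists_right H
      exact ⟨⟨ModuleCat.of R K, hK⟩, h⟩)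
    ⟨ModuleCat.of R M, hM⟩
  choose F _ _ j p hF hj hex hp hI using hN
  refine ⟨F, inferInstance, inferInstance, fun i ↦ (j (i + 1)).comp (p i), hF, fun i ↦ ?_, ?_,
    fun E _ _ hE i ↦ ?_⟩
  · rw [LinearMap.range_comp, LinearMap.range_eq_top.mpr (hp i), Submodule.map_top,
      LinearMap.ker_comp_of_ker_eq_bot _ (LinearMap.ker_eq_bot.mpr (hj _)),
      (hex (i + 1)).linearMap_ker_eq]
  · have e : (N (0 + 1)).1 ≃ₗ[R] LinearMap.range ((j (0 + 1)).comp (p 0)) :=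
      (LinearEquiv.ofInjective _ (hj _)).trans (LinearEquiv.ofEq _ _ (by
        rw [LinearMap.range_comp, LinearMap.range_eq_top.mpr (hp 0), Submodule.map_top]))
    have e' : Nonempty (M ≃ₗ[R] (N (0 + 1)).1) := by
      rw [zero_add, hN1]
      exact ⟨LinearEquiv.refl R M⟩
    exact e'.map fun e' ↦ e'.trans e
  · rw [LinearMap.rTensor_comp, LinearMap.rTensor_comp, LinearMap.range_comp,
      LinearMap.range_eq_top.mpr (LinearMap.rTensor_surjective E (hp i)), Submodule.map_top,
      LinearMap.ker_comp_of_ker_eq_bot _ (LinearMap.ker_eq_bot.mpr (hI _ E _ _ hE)),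
      (rTensor_exact E (hex (i + 1)) (hp (i + 1))).linearMap_ker_eq]

theorem IsFinitelyPresented.finitePresentation {M : Type u} [AddCommGroup M] [Module R M]
    (hM : IsFinitelyPresented R M) : Module.FinitePresentation R M := by
  obtain ⟨n, f, hf, hker⟩ := hM
  exact Module.finitePresentation_of_surjective f hf hker

theorem isFinitelyPresented_of_finitePresentation (M : Type u) [AddCommGroup M] [Module R M]
    [Module.FinitePresentation R M] : IsFinitelyPresented R M := by
  obtain ⟨n, f, hf⟩ := Module.Finite.exists_fin' R M
  exact ⟨n, f, hf, Module.FinitePresentation.fg_ker f hf⟩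

theorem IsStronglyGorensteinFlat.isStronglyGorensteinProjective {M : Type u} [AddCommGroup M]
    [Module R M] [Module.FinitePresentation R M] (hM : IsStronglyGorensteinFlat R M) :
    IsStronglyGorensteinProjective R M := by
  obtain ⟨F, _, _, f, hF, hf, ⟨e⟩, hI⟩ := hM
  have : Module.FinitePresentation R (LinearMap.range f) := .of_equiv e
  have : Module.FinitePresentation R (LinearMap.ker f.rangeRestrict) :=
    .of_equiv (LinearEquiv.ofEq _ _ (hf.trans (LinearMap.ker_rangeRestrict f).symm))
  have : Module.FinitePresentation R F :=
    Module.finitePresentation_of_ker f.rangeRestrict f.surjective_rangeRestrict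
  have : Module.Projective R F := Module.Flat.projective_of_finitePresentation
  refine ⟨F, _, _, f, this, hf, ⟨e⟩, fun Q _ _ hQ v hv ↦
    exists_comp_eq_of_rTensor f (fun t ht ↦ ?_) v hv⟩
  rw [← LinearMap.mem_ker, ← hI _ _ _ (injective_hom_characterModule Q)] at ht
  exact ht

end

/-- Theorem 3.5: if every Gorenstein flat module is strongly Gorenstein flat, then `R` is
strongly Gorenstein semihereditary iff every finitely generated ideal is strongly Gorenstein
projective. -/
theorem statement_16 (R : Type u) [CommRing R]
    (h : ∀ (M : Type u) (_ : AddCommGroup M) (_ : Module R M),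
      IsGorensteinFlat R M → IsStronglyGorensteinFlat R M) :
    IsSGSemihereditaryRing R ↔
      ∀ I : Ideal R, I.FG → IsStronglyGorensteinProjective R I := by
  refine ⟨fun hR I hI ↦ ?_, fun H ↦ ⟨fun I hI ↦ ?_, fun F _ _ hF N ↦ ?_⟩⟩
  · have := (hR.1 I hI).finitePresentation
    exact (hR.2 R _ _ inferInstance I).isStronglyGorensteinProjective
  · have := finitePresentation_of_isStronglyGorensteinProjective (H I hI) hI
    exact isFinitelyPresented_of_finitePresentation I
  · exact h N _ _ (IsSubflat.isGorensteinFlat H ⟨F, _, _, N.subtype, hF, N.injective_subtype⟩)
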